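/- Let A ∈ C¹(𝓑(x₀,2r); ℝ^d) and let u ∈ C²(𝓑(x₀,2r); ℂ) satisfy (D+A)²u = F in 𝓑(x₀,2r). Let 2 ≤ p < q ≤ ∞ with 1/p − 1/q < 2/d. Then (⨍_{𝓑(x₀,r)} |u|^q)^{1/q} ≤ C ⨍_{𝓑(x₀,2r)} |u| + C r² (⨍_{𝓑(x₀,2r)} |F|^p)^{1/p}, where C depends only on d, p and q. -/

import Mathlib

open MeasureTheory Metric Set
open scoped ENNReal NNReal ComplexConjugate

noncomputable section

/-- `ℝ^d` with the Euclidean norm. -/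
abbrev Euc (d : ℕ) := EuclideanSpace ℝ (Fin d)

/-- The partial derivative `∂_j u (x)`. -/
noncomputable def pd {d : ℕ} {F : Type*} [NormedAddCommGroup F] [NormedSpace ℝ F]
    (u : Euc d → F) (j : Fin d) (x : Euc d) : F :=
  fderiv ℝ u x (EuclideanSpace.single j 1)

/-- The magnetic derivative component `(D_j + A_j) u = -i ∂_j u + A_j u`. -/
noncomputable def mOp {d : ℕ} (A : Euc d → Fin d → ℝ) (j : Fin d)
    (u : Euc d → ℂ) (x : Euc d) : ℂ :=
  -Complex.I * pd u j x + (A x j : ℂ) * u x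

/-- The magnetic Laplacian `(D+A)² u = Σ_j (D_j+A_j)((D_j+A_j) u)`. -/
noncomputable def magLap {d : ℕ} (A : Euc d → Fin d → ℝ) (u : Euc d → ℂ) (x : Euc d) : ℂ :=
  ∑ j, mOp A j (fun y => mOp A j u y) x

/-- The normalized (probability) measure on the ball `𝓑(x₀, r)`; the `L^q` norm with respect
to it is the averaged norm `(⨍_{𝓑(x₀,r)} |u|^q)^{1/q}` (essential sup when `q = ∞`). -/
noncomputable def avgMeasure {d : ℕ} (x₀ : Euc d) (r : ℝ) : Measure (Euc d) :=
  (volume (ball x₀ r))⁻¹ • volume.restrict (ball x₀ r)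

lemma hasDerivAt_line {d : ℕ} {F : Type*} [NormedAddCommGroup F] [NormedSpace ℝ F]
    {f : Euc d → F} {x : Euc d} (hf : DifferentiableAt ℝ f x) (j : Fin d) :
    HasDerivAt (fun t : ℝ => f (x + t • EuclideanSpace.single j (1 : ℝ))) (pd f j x) 0 :=
  hf.hasFDerivAt.hasLineDerivAt _

lemma pd_eq_of_hasDerivAt_line {d : ℕ} {F : Type*} [NormedAddCommGroup F] [NormedSpace ℝ F]
    {f : Euc d → F} {x : Euc d} (hf : DifferentiableAt ℝ f x) {j : Fin d} {f' : F}
    (h : HasDerivAt (fun t : ℝ => f (x + t • EuclideanSpace.single j (1 : ℝ))) f' 0) :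
    pd f j x = f' :=
  (hasDerivAt_line hf j).unique h

lemma pd_congr {d : ℕ} {F : Type*} [NormedAddCommGroup F] [NormedSpace ℝ F]
    {f g : Euc d → F} {x : Euc d} (h : f =ᶠ[nhds x] g) (j : Fin d) : pd f j x = pd g j x := by
  simp [pd, h.fderiv_eq]

lemma contDiffAt_pd {d : ℕ} {F : Type*} [NormedAddCommGroup F] [NormedSpace ℝ F]
    {f : Euc d → F} {x : Euc d} {m n : WithTop ℕ∞} (hf : ContDiffAt ℝ n f x) (h : m + 1 ≤ n)
    (j : Fin d) : ContDiffAt ℝ m (pd f j) x :=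
  (hf.fderiv_right h).clm_apply contDiffAt_const

/-- The regularized modulus `√(|u|² + ε²)`. -/
def regAbs {d : ℕ} (u : Euc d → ℂ) (ε : ℝ) (x : Euc d) : ℝ :=
  √((u x).re ^ 2 + (u x).im ^ 2 + ε ^ 2)

lemma regAbs_pos {d : ℕ} (u : Euc d → ℂ) {ε : ℝ} (hε : 0 < ε) (x : Euc d) :
    0 < regAbs u ε x := by
  unfold regAbs; positivity

lemma regAbs_sq {d : ℕ} (u : Euc d → ℂ) (ε : ℝ) (x : Euc d) :
    regAbs u ε x ^ 2 = (u x).re ^ 2 + (u x).im ^ 2 + ε ^ 2 :=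
  Real.sq_sqrt (by positivity)

lemma norm_le_regAbs {d : ℕ} (u : Euc d → ℂ) (ε : ℝ) (x : Euc d) : ‖u x‖ ≤ regAbs u ε x := by
  refine Real.le_sqrt_of_sq_le ?_
  rw [Complex.sq_norm, Complex.normSq_apply]
  nlinarith [sq_nonneg ε]

lemma regAbs_le {d : ℕ} (u : Euc d → ℂ) {ε : ℝ} (hε : 0 < ε) (x : Euc d) :
    regAbs u ε x ≤ ‖u x‖ + ε := by
  refine Real.sqrt_le_iff.2 ⟨by positivity, ?_⟩
  have := Complex.sq_norm (u x)
  rw [Complex.normSq_apply] at this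
  nlinarith [mul_nonneg (norm_nonneg (u x)) hε.le]

lemma contDiffAt_regAbs {d : ℕ} {u : Euc d → ℂ} {ε : ℝ} (hε : 0 < ε) {x : Euc d}
    {n : WithTop ℕ∞} (hu : ContDiffAt ℝ n u x) : ContDiffAt ℝ n (regAbs u ε) x := by
  have hre : ContDiffAt ℝ n (fun y => (u y).re) x := Complex.reCLM.contDiff.contDiffAt.comp x hu
  have him : ContDiffAt ℝ n (fun y => (u y).im) x := Complex.imCLM.contDiff.contDiffAt.comp x hu
  exact (((hre.pow 2).add (him.pow 2)).add contDiffAt_const).sqrt (by positivity)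

lemma hasDerivAt_re_im {f : ℝ → ℂ} {f' : ℂ} {t : ℝ} (h : HasDerivAt f f' t) :
    HasDerivAt (fun s => (f s).re) f'.re t ∧ HasDerivAt (fun s => (f s).im) f'.im t :=
  ⟨Complex.reCLM.hasFDerivAt.comp_hasDerivAt t h, Complex.imCLM.hasFDerivAt.comp_hasDerivAt t h⟩

lemma pd_regAbs {d : ℕ} {u : Euc d → ℂ} {ε : ℝ} (hε : 0 < ε) {x : Euc d}
    (hu : ContDiffAt ℝ 1 u x) (j : Fin d) :
    pd (regAbs u ε) j x =
      ((u x).re * (pd u j x).re + (u x).im * (pd u j x).im) / regAbs u ε x := by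
  refine pd_eq_of_hasDerivAt_line ((contDiffAt_regAbs hε hu).differentiableAt one_ne_zero) ?_
  obtain ⟨h1, h2⟩ := hasDerivAt_re_im (hasDerivAt_line (hu.differentiableAt one_ne_zero) j)
  have h := (((h1.pow 2).add (h2.pow 2)).add_const (ε ^ 2)).sqrt
    (by simp only [zero_smul, add_zero, Pi.add_apply, Pi.pow_apply]; positivity)
  convert! h using 1
  simp only [zero_smul, add_zero, Pi.add_apply, Pi.pow_apply]
  rw [← regAbs]
  have := (regAbs_pos u hε x).ne'
  field_simp
  ring

lemma mOp_mOp {d : ℕ} {A : Euc d → Fin d → ℝ} {u : Euc d → ℂ} {x : Euc d}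
    (hA : ContDiffAt ℝ 1 A x) (hu : ContDiffAt ℝ 2 u x) (j : Fin d) :
    mOp A j (fun y => mOp A j u y) x =
      -pd (pd u j) j x - Complex.I * (pd (fun y => A y j) j x : ℝ) * u x
        - 2 * Complex.I * A x j * pd u j x + (A x j : ℂ) ^ 2 * u x := by
  have hAj : DifferentiableAt ℝ (fun y => A y j) x :=
    (differentiableAt_pi.1 (hA.differentiableAt one_ne_zero)) j
  have hu1 : DifferentiableAt ℝ u x := hu.differentiableAt two_ne_zero
  have hu2 : DifferentiableAt ℝ (pd u j) x :=
    (contDiffAt_pd (m := 1) hu (by norm_num [one_add_one_eq_two]) j).differentiableAt one_ne_zero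
  have hAc : DifferentiableAt ℝ (fun y => (A y j : ℂ)) x :=
    Complex.ofRealCLM.differentiableAt.comp x hAj
  have key : pd (fun y => mOp A j u y) j x = -Complex.I * pd (pd u j) j x +
      ((pd (fun y => A y j) j x : ℝ) * u x + (A x j : ℂ) * pd u j x) := by
    refine pd_eq_of_hasDerivAt_line ((hu2.const_mul _).add (hAc.mul hu1)) ?_
    have h := ((hasDerivAt_line hu2 j).const_mul (-Complex.I)).add
      ((hasDerivAt_line hAj j).ofReal_comp.mul (hasDerivAt_line hu1 j))
    convert! h using 1
    simp
  rw [mOp, key, mOp]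
  linear_combination (-pd (pd u j) j x) * (-Complex.I_sq)

lemma neg_re_mOp_mOp_le {d : ℕ} {A : Euc d → Fin d → ℝ} {u : Euc d → ℂ} {ε : ℝ} (hε : 0 < ε)
    {x : Euc d} (hA : ContDiffAt ℝ 1 A x) (hu : ContDiffAt ℝ 2 u x) (j : Fin d) :
    -(conj (u x) * mOp A j (fun y => mOp A j u y) x).re ≤
      regAbs u ε x * pd (pd (regAbs u ε) j) j x := by
  have hev : pd (regAbs u ε) j =ᶠ[nhds x] fun y =>
      ((u y).re * (pd u j y).re + (u y).im * (pd u j y).im) / regAbs u ε y := by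
    filter_upwards [(hu.of_le one_le_two).eventually (by simp)] with y hy
    exact pd_regAbs hε hy j
  have hwd := contDiffAt_regAbs hε hu
  have hd : DifferentiableAt ℝ (pd (regAbs u ε) j) x :=
    (contDiffAt_pd (m := 1) hwd (by norm_num [one_add_one_eq_two]) j).differentiableAt one_ne_zero
  have hu2 : DifferentiableAt ℝ (pd u j) x :=
    (contDiffAt_pd (m := 1) hu (by norm_num [one_add_one_eq_two]) j).differentiableAt one_ne_zero
  have hw := regAbs_pos u hε x
  have hsq := regAbs_sq u ε x
  have hw1 := pd_regAbs hε (hu.of_le one_le_two) j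
  have hw2 : pd (pd (regAbs u ε) j) j x =
      (((pd u j x).re * (pd u j x).re + (u x).re * (pd (pd u j) j x).re +
        ((pd u j x).im * (pd u j x).im + (u x).im * (pd (pd u j) j x).im)) * regAbs u ε x -
        ((u x).re * (pd u j x).re + (u x).im * (pd u j x).im) * pd (regAbs u ε) j x) /
          regAbs u ε x ^ 2 := by
    rw [pd_congr hev]
    refine pd_eq_of_hasDerivAt_line (hd.congr_of_eventuallyEq hev.symm) ?_
    obtain ⟨h1, h2⟩ := hasDerivAt_re_im (hasDerivAt_line (hu.differentiableAt two_ne_zero) j)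
    obtain ⟨h3, h4⟩ := hasDerivAt_re_im (hasDerivAt_line hu2 j)
    have h5 := hasDerivAt_line (hwd.differentiableAt two_ne_zero) j
    have h := ((h1.mul h3).add (h2.mul h4)).div h5 (by simpa using hw.ne')
    convert! h using 1
    simp
  rw [hw2, hw1, mOp_mOp hA hu j]
  generalize regAbs u ε x = w at *
  generalize pd (pd u j) j x = u2 at *
  generalize pd u j x = u1 at *
  generalize pd (fun y => A y j) j x = a' at *
  generalize A x j = a at *
  generalize u x = v at *
  obtain ⟨v1, v2⟩ := v
  obtain ⟨p1, p2⟩ := u1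
  obtain ⟨s1, s2⟩ := u2
  simp [pow_two] at hsq ⊢
  have e : w * (((p1 * p1 + v1 * s1 + (p2 * p2 + v2 * s2)) * w -
      (v1 * p1 + v2 * p2) * ((v1 * p1 + v2 * p2) / w)) / (w * w)) =
      (p1 * p1 + v1 * s1 + (p2 * p2 + v2 * s2)) - (v1 * p1 + v2 * p2) ^ 2 / w ^ 2 := by
    field_simp
  rw [e]
  have h6 : (v1 * p1 + v2 * p2) ^ 2 / w ^ 2 ≤ (p1 - a * v2) ^ 2 + (p2 + a * v1) ^ 2 := by
    rw [div_le_iff₀ (by positivity), pow_two w, hsq]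
    have : v1 * p1 + v2 * p2 = v1 * (p1 - a * v2) + v2 * (p2 + a * v1) := by ring
    rw [this]
    generalize p1 - a * v2 = X
    generalize p2 + a * v1 = Y
    nlinarith [sq_nonneg (v1 * Y - v2 * X), mul_nonneg (sq_nonneg X) (sq_nonneg ε),
      mul_nonneg (sq_nonneg Y) (sq_nonneg ε)]
  linarith

/-- **Kato's inequality** for the magnetic Laplacian, in regularized form. -/
lemma neg_norm_magLap_le {d : ℕ} {A : Euc d → Fin d → ℝ} {u : Euc d → ℂ} {ε : ℝ} (hε : 0 < ε)
    {x : Euc d} (hA : ContDiffAt ℝ 1 A x) (hu : ContDiffAt ℝ 2 u x) :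
    -‖magLap A u x‖ ≤ ∑ j, pd (pd (regAbs u ε) j) j x := by
  have hw := regAbs_pos u hε x
  have h1 : -(conj (u x) * magLap A u x).re ≤
      regAbs u ε x * ∑ j, pd (pd (regAbs u ε) j) j x := by
    rw [magLap, Finset.mul_sum, Complex.re_sum, Finset.mul_sum, ← Finset.sum_neg_distrib]
    exact Finset.sum_le_sum fun j _ => neg_re_mOp_mOp_le hε hA hu j
  have h2 : (conj (u x) * magLap A u x).re ≤ ‖u x‖ * ‖magLap A u x‖ := by
    refine (Complex.re_le_norm _).trans_eq ?_
    rw [norm_mul, Complex.norm_conj]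
  have h3 := mul_le_mul_of_nonneg_right (norm_le_regAbs u ε x) (norm_nonneg (magLap A u x))
  refine le_of_mul_le_mul_left ?_ hw
  linarith

lemma hasDerivAt_max_zero_sq (s : ℝ) : HasDerivAt (fun t : ℝ => max t 0 ^ 2) (2 * max s 0) s := by
  have hne : ∀ y : ℝ, y ≠ 0 → HasDerivAt (fun t : ℝ => max t 0 ^ 2) (2 * max y 0) y := by
    intro y hy
    rcases lt_or_gt_of_ne hy with h | h
    · rw [max_eq_right h.le, mul_zero]
      refine (hasDerivAt_const y (0 : ℝ)).congr_of_eventuallyEq ?_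
      filter_upwards [eventually_lt_nhds h] with t ht
      simp [max_eq_right ht.le]
    · rw [max_eq_left h.le]
      have := hasDerivAt_pow 2 y
      simp only [Nat.cast_ofNat, Nat.add_one_sub_one, pow_one] at this
      refine this.congr_of_eventuallyEq ?_
      filter_upwards [eventually_gt_nhds h] with t ht
      simp [max_eq_left ht.le]
  rcases eq_or_ne s 0 with rfl | h
  · exact hasDerivAt_of_hasDerivAt_of_ne (g := fun y => 2 * max y 0) hne (by fun_prop)
      (by fun_prop)
  · exact hne s h

/-- A radial kernel supported in the unit ball. -/
def radialKer {d : ℕ} (z : Euc d) : ℝ := max (1 - ‖z‖ ^ 2) 0 ^ 2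

/-- The radial kernel `η` with `∇ radialKer = -η(z) z`. -/
def radialKerDeriv {d : ℕ} (z : Euc d) : ℝ := 4 * max (1 - ‖z‖ ^ 2) 0

lemma hasFDerivAt_radialKer {d : ℕ} (z : Euc d) :
    HasFDerivAt (radialKer (d := d)) (-radialKerDeriv z • innerSL ℝ z) z := by
  have h := (hasDerivAt_max_zero_sq (1 - ‖z‖ ^ 2)).comp_hasFDerivAt z
    ((hasStrictFDerivAt_norm_sq z).hasFDerivAt.const_sub 1)
  convert! h using 1
  ext y
  simp [radialKerDeriv]
  ring

lemma pd_radialKer {d : ℕ} (z : Euc d) (j : Fin d) :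
    pd radialKer j z = -radialKerDeriv z * z j := by
  simp [pd, (hasFDerivAt_radialKer z).fderiv, EuclideanSpace.inner_single_right]

lemma continuous_radialKer {d : ℕ} : Continuous (radialKer (d := d)) := by
  unfold radialKer; fun_prop

lemma continuous_radialKerDeriv {d : ℕ} : Continuous (radialKerDeriv (d := d)) := by
  unfold radialKerDeriv; fun_prop

lemma max_one_sub_sq_eq_zero {d : ℕ} {z : Euc d} (hz : z ∉ ball (0 : Euc d) 1) :
    max (1 - ‖z‖ ^ 2) 0 = 0 := by
  have : 1 ≤ ‖z‖ := by simpa using hz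
  exact max_eq_right (by nlinarith)

lemma radialKer_eq_zero {d : ℕ} {z : Euc d} (hz : z ∉ ball (0 : Euc d) 1) : radialKer z = 0 := by
  simp [radialKer, max_one_sub_sq_eq_zero hz]

lemma radialKerDeriv_eq_zero {d : ℕ} {z : Euc d} (hz : z ∉ ball (0 : Euc d) 1) :
    radialKerDeriv z = 0 := by
  simp [radialKerDeriv, max_one_sub_sq_eq_zero hz]

lemma radialKer_nonneg {d : ℕ} (z : Euc d) : 0 ≤ radialKer z := sq_nonneg _

lemma radialKerDeriv_nonneg {d : ℕ} (z : Euc d) : 0 ≤ radialKerDeriv z := by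
  unfold radialKerDeriv; positivity

lemma radialKer_le_one {d : ℕ} (z : Euc d) : radialKer z ≤ 1 :=
  pow_le_one₀ (le_max_right _ _) (max_le (by nlinarith [norm_nonneg z]) zero_le_one)

lemma radialKerDeriv_le {d : ℕ} (z : Euc d) : radialKerDeriv z ≤ 4 := by
  have : max (1 - ‖z‖ ^ 2) 0 ≤ 1 := max_le (by nlinarith [norm_nonneg z]) zero_le_one
  unfold radialKerDeriv; linarith

lemma hasCompactSupport_of_eq_zero {d : ℕ} {f : Euc d → ℝ}
    (h : ∀ z, z ∉ ball (0 : Euc d) 1 → f z = 0) : HasCompactSupport f :=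
  HasCompactSupport.intro (isCompact_closedBall 0 1) fun z hz =>
    h z fun h' => hz (ball_subset_closedBall h')

lemma fderiv_apply_eq_sum_pd {d : ℕ} (W : Euc d → ℝ) (y z : Euc d) :
    fderiv ℝ W y z = ∑ j, z j * pd W j y := by
  conv_lhs => rw [← (EuclideanSpace.basisFun (Fin d) ℝ).sum_repr z]
  simp [pd]

lemma continuous_pd {d : ℕ} {W : Euc d → ℝ} {n : WithTop ℕ∞} (hW : ContDiff ℝ n W) (hn : n ≠ 0)
    (j : Fin d) : Continuous (pd W j) :=
  (hW.continuous_fderiv hn).clm_apply continuous_const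

lemma contDiff_pd {d : ℕ} {W : Euc d → ℝ} {m n : WithTop ℕ∞} (hW : ContDiff ℝ n W)
    (h : m + 1 ≤ n) (j : Fin d) : ContDiff ℝ m (pd W j) :=
  contDiff_iff_contDiffAt.2 fun _ => contDiffAt_pd hW.contDiffAt h j

lemma integral_radialKer_mul_pd {d : ℕ} {g : Euc d → ℝ} (hg : ContDiff ℝ 1 g) (x : Euc d) (c : ℝ)
    (j : Fin d) : ∫ z, radialKerDeriv z * (z j * g (x + c • z)) =
      c * ∫ z, radialKer z * pd g j (x + c • z) := by
  have hgc : ContDiff ℝ 1 (fun z => g (x + c • z)) := by fun_prop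
  have hpd : ∀ z, fderiv ℝ (fun z => g (x + c • z)) z (EuclideanSpace.single j 1) =
      c * pd g j (x + c • z) := by
    intro z
    have h1 : HasFDerivAt (fun z : Euc d => x + c • z) (c • ContinuousLinearMap.id ℝ (Euc d)) z :=
      ((hasFDerivAt_id z).const_smul c).const_add x
    have := ((hg.differentiable one_ne_zero (x + c • z)).hasFDerivAt.comp z h1).fderiv
    simp only [Function.comp_def] at this
    simp [this, pd]
  have hK : ∀ z, fderiv ℝ radialKer z (EuclideanSpace.single j 1) = -radialKerDeriv z * z j :=
    fun z => pd_radialKer z j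
  have hcont := continuous_pd hg one_ne_zero j
  have hg0 := hg.continuous
  have := integral_mul_fderiv_eq_neg_fderiv_mul_of_integrable (μ := volume)
    (f := radialKer) (g := fun z => g (x + c • z)) (v := EuclideanSpace.single j (1 : ℝ))
    (by
      simp only [hK]
      refine Continuous.integrable_of_hasCompactSupport ?_
        (hasCompactSupport_of_eq_zero fun z hz => by simp [radialKerDeriv_eq_zero hz])
      have := continuous_radialKerDeriv (d := d)
      fun_prop)
    (by
      simp only [hpd]
      refine Continuous.integrable_of_hasCompactSupport ?_
        (hasCompactSupport_of_eq_zero fun z hz => by simp [radialKer_eq_zero hz])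
      have := continuous_radialKer (d := d)
      fun_prop)
    (by
      refine Continuous.integrable_of_hasCompactSupport ?_
        (hasCompactSupport_of_eq_zero fun z hz => by simp [radialKer_eq_zero hz])
      have := continuous_radialKer (d := d)
      fun_prop)
    (fun z _ => (hasFDerivAt_radialKer z).differentiableAt)
    (fun z _ => hgc.differentiable one_ne_zero z)
  simp only [hpd, hK] at this
  rw [← integral_const_mul, ← integral_neg] at *
  calc _ = ∫ z, -(-radialKerDeriv z * z j * g (x + c • z)) := by congr 1; ext z; ring
    _ = ∫ z, radialKer z * (c * pd g j (x + c • z)) := this.symm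
    _ = _ := by congr 1; ext z; ring

lemma integral_radialKerDeriv_mul_fderiv {d : ℕ} {W : Euc d → ℝ} (hW : ContDiff ℝ 2 W)
    (x : Euc d) (c : ℝ) : ∫ z, radialKerDeriv z * fderiv ℝ W (x + c • z) z =
      c * ∫ z, radialKer z * ∑ j, pd (pd W j) j (x + c • z) := by
  have h1 : ∀ j, ContDiff ℝ 1 (pd W j) := fun j =>
    contDiff_pd hW (by norm_num [one_add_one_eq_two]) j
  simp only [fderiv_apply_eq_sum_pd, Finset.mul_sum]
  rw [integral_finsetSum, integral_finsetSum, Finset.mul_sum]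
  · exact Finset.sum_congr rfl fun j _ => integral_radialKer_mul_pd (h1 j) x c j
  · intro j _
    refine Continuous.integrable_of_hasCompactSupport ?_
      (hasCompactSupport_of_eq_zero fun z hz => by simp [radialKer_eq_zero hz])
    have := continuous_radialKer (d := d)
    have := continuous_pd (h1 j) one_ne_zero j
    fun_prop
  · intro j _
    refine Continuous.integrable_of_hasCompactSupport ?_
      (hasCompactSupport_of_eq_zero fun z hz => by simp [radialKerDeriv_eq_zero hz])
    have := continuous_radialKerDeriv (d := d)
    have := (h1 j).continuous
    fun_prop

lemma integral_radialKerDeriv_mul_sub {d : ℕ} {W : Euc d → ℝ} (hW : ContDiff ℝ 2 W)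
    (x : Euc d) (ρ S : ℝ) :
    ∫ z, radialKerDeriv z * (W (x + (ρ * S) • z) - W x) =
      ρ ^ 2 * ∫ s in (0 : ℝ)..S, s * ∫ z, radialKer z * ∑ j, pd (pd W j) j (x + (ρ * s) • z) := by
  have hfd : Continuous (fderiv ℝ W) := hW.continuous_fderiv two_ne_zero
  have hKc := continuous_radialKerDeriv (d := d)
  have hcont : Continuous fun q : ℝ × Euc d =>
      radialKerDeriv q.2 * (ρ * fderiv ℝ W (x + (ρ * q.1) • q.2) q.2) := by
    have : Continuous fun q : ℝ × Euc d => fderiv ℝ W (x + (ρ * q.1) • q.2) q.2 :=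
      (hfd.comp (by fun_prop)).clm_apply continuous_snd
    fun_prop
  have hftc : ∀ z : Euc d, W (x + (ρ * S) • z) - W x =
      ∫ s in (0 : ℝ)..S, ρ * fderiv ℝ W (x + (ρ * s) • z) z := by
    intro z
    have hd : ∀ s ∈ uIcc 0 S, HasDerivAt (fun s : ℝ => W (x + (ρ * s) • z))
        (ρ * fderiv ℝ W (x + (ρ * s) • z) z) s := by
      intro s _
      have h1 : HasDerivAt (fun s : ℝ => x + (ρ * s) • z) (ρ • z) s := by
        have := (((hasDerivAt_id s).const_mul ρ).smul_const z).const_add x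
        simpa using this
      have := (hW.differentiable two_ne_zero (x + (ρ * s) • z)).hasFDerivAt.comp_hasDerivAt s h1
      simpa [Function.comp_def] using this
    rw [intervalIntegral.integral_eq_sub_of_hasDerivAt hd]
    · simp
    · have : Continuous fun s : ℝ => fderiv ℝ W (x + (ρ * s) • z) z :=
        (hfd.comp (by fun_prop)).clm_apply continuous_const
      exact (continuous_const.mul this).intervalIntegrable _ _
  have hball : ∀ f : Euc d → ℝ, ∫ z, radialKerDeriv z * f z =
      ∫ z in closedBall (0 : Euc d) 1, radialKerDeriv z * f z := fun f =>
    (setIntegral_eq_integral_of_forall_compl_eq_zero fun z hz => by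
      rw [radialKerDeriv_eq_zero fun h' => hz (ball_subset_closedBall h'), zero_mul]).symm
  calc ∫ z, radialKerDeriv z * (W (x + (ρ * S) • z) - W x)
      = ∫ z in closedBall (0 : Euc d) 1, ∫ s in (0 : ℝ)..S,
          radialKerDeriv z * (ρ * fderiv ℝ W (x + (ρ * s) • z) z) := by
        rw [hball]
        simp only [hftc, intervalIntegral.integral_const_mul]
    _ = ∫ s in (0 : ℝ)..S, ∫ z in closedBall (0 : Euc d) 1,
          radialKerDeriv z * (ρ * fderiv ℝ W (x + (ρ * s) • z) z) := by
        refine (intervalIntegral_integral_swap ?_).symm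
        rw [Measure.prod_restrict]
        refine IntegrableOn.mono_set (t := uIcc 0 S ×ˢ closedBall (0 : Euc d) 1) ?_
          (prod_mono uIoc_subset_uIcc subset_rfl)
        exact hcont.continuousOn.integrableOn_compact
          (isCompact_uIcc.prod (isCompact_closedBall 0 1))
    _ = ∫ s in (0 : ℝ)..S, ρ ^ 2 * (s * ∫ z, radialKer z *
          ∑ j, pd (pd W j) j (x + (ρ * s) • z)) := by
        congr 1
        ext s
        rw [← hball]
        calc _ = ∫ z, ρ * (radialKerDeriv z * fderiv ℝ W (x + (ρ * s) • z) z) := by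
              congr 1; ext z; ring
          _ = _ := by
              rw [integral_const_mul, integral_radialKerDeriv_mul_fderiv hW]; ring
    _ = _ := intervalIntegral.integral_const_mul _ _

lemma lintegral_ball_comp_le {d : ℕ} (g : Euc d → ℝ≥0∞) (x : Euc d) {c : ℝ} (hc : 0 < c) :
    ∫⁻ z in ball (0 : Euc d) 1, g (x + c • z) ≤ (ENNReal.ofReal (c ^ d))⁻¹ * ∫⁻ y, g y := by
  refine (setLIntegral_le_lintegral _ _).trans (le_of_eq ?_)
  have h1 : ∫⁻ z, g (x + c • z) = ∫⁻ y, g (x + y) ∂(Measure.map (fun z : Euc d => c • z) volume) :=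
    ((Homeomorph.smulOfNeZero c hc.ne').measurableEmbedding.lintegral_map
      (fun y : Euc d => g (x + y))).symm
  rw [h1, Measure.map_addHaar_smul _ hc.ne', lintegral_smul_measure,
    lintegral_add_left_eq_self (fun y => g y) x, smul_eq_mul, abs_of_pos (by positivity),
    finrank_euclideanSpace_fin, ENNReal.ofReal_inv_of_pos (by positivity)]

lemma volume_ball_eq {d : ℕ} (x : Euc d) {r : ℝ} (hr : 0 < r) :
    volume (ball x r) = ENNReal.ofReal (r ^ d) * volume (ball (0 : Euc d) 1) := by
  rw [Measure.addHaar_ball_of_pos _ _ hr, finrank_euclideanSpace_fin]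

lemma volume_ball_ne_zero {d : ℕ} (x : Euc d) {r : ℝ} (hr : 0 < r) : volume (ball x r) ≠ 0 :=
  (measure_ball_pos _ _ hr).ne'

lemma volume_ball_ne_top {d : ℕ} (x : Euc d) (r : ℝ) : volume (ball x r) ≠ ∞ :=
  measure_ball_lt_top.ne

lemma isProbabilityMeasure_avgMeasure {d : ℕ} (x₀ : Euc d) {r : ℝ} (hr : 0 < r) :
    IsProbabilityMeasure (avgMeasure x₀ r) :=
  ⟨by simp [avgMeasure, ENNReal.inv_mul_cancel (volume_ball_ne_zero x₀ hr)
    (volume_ball_ne_top x₀ r)]⟩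

lemma lintegral_avgMeasure {d : ℕ} (x₀ : Euc d) (r : ℝ) (g : Euc d → ℝ≥0∞) :
    ∫⁻ x, g x ∂(avgMeasure x₀ r) = (volume (ball x₀ r))⁻¹ * ∫⁻ x in ball x₀ r, g x := by
  rw [avgMeasure, lintegral_smul_measure, smul_eq_mul]

/-- The potential of `f` obtained by averaging over the balls of radius at most `r / 2`. -/
def ballPotential {d : ℕ} (r : ℝ) (f : Euc d → ℝ≥0∞) (x : Euc d) : ℝ≥0∞ :=
  ∫⁻ s in Ioo (0 : ℝ) (1 / 2), ENNReal.ofReal s * ∫⁻ z in ball (0 : Euc d) 1, f (x + (r * s) • z)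

section Potential

variable {d : ℕ} {f : Euc d → ℝ≥0∞}

lemma measurable_comp_line (hf : Measurable f) (r : ℝ) :
    Measurable fun q : (Euc d × ℝ) × Euc d => f (q.1.1 + (r * q.1.2) • q.2) :=
  hf.comp (by fun_prop)

lemma measurable_ball_lintegral (hf : Measurable f) (r : ℝ) :
    Measurable fun q : Euc d × ℝ => ∫⁻ z in ball (0 : Euc d) 1, f (q.1 + (r * q.2) • z) :=
  (measurable_comp_line hf r).lintegral_prod_right'

lemma measurable_ballPotential (hf : Measurable f) (r : ℝ) : Measurable (ballPotential r f) := by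
  have := measurable_ball_lintegral hf r
  exact Measurable.lintegral_prod_right' (f := fun q : Euc d × ℝ =>
    ENNReal.ofReal q.2 * ∫⁻ z in ball (0 : Euc d) 1, f (q.1 + (r * q.2) • z)) (by fun_prop)

lemma ball_lintegral_le (f : Euc d → ℝ≥0∞) (x₀ x : Euc d) {r s : ℝ} (hr : 0 < r) (hs : 0 < s) :
    ∫⁻ z in ball (0 : Euc d) 1, f (x + (r * s) • z) ≤ ENNReal.ofReal (s ^ (-(d : ℝ))) *
      (volume (ball (0 : Euc d) 1) * ((volume (ball x₀ r))⁻¹ * ∫⁻ y, f y)) := by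
  refine (lintegral_ball_comp_le f x (mul_pos hr hs)).trans (le_of_eq ?_)
  have hβ := volume_ball_ne_zero (0 : Euc d) one_pos
  have hβ' := volume_ball_ne_top (0 : Euc d) 1
  rw [volume_ball_eq x₀ hr, ENNReal.mul_inv (.inr hβ') (.inr hβ), ← mul_assoc, ← mul_assoc]
  congr 1
  rw [mul_pow, ENNReal.ofReal_mul (by positivity), ENNReal.mul_inv (by simp) (by simp),
    Real.rpow_neg hs.le, Real.rpow_natCast, ENNReal.ofReal_inv_of_pos (by positivity)]
  calc _ = (ENNReal.ofReal (s ^ d))⁻¹ * (ENNReal.ofReal (r ^ d))⁻¹ *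
        (volume (ball (0 : Euc d) 1) * (volume (ball (0 : Euc d) 1))⁻¹) := by
        rw [ENNReal.mul_inv_cancel hβ hβ']; ring
    _ = _ := by ring

lemma lintegral_ball_lintegral_le (hf : Measurable f) (x₀ : Euc d) (r s : ℝ) :
    ∫⁻ x, (∫⁻ z in ball (0 : Euc d) 1, f (x + (r * s) • z)) ∂(avgMeasure x₀ r) ≤
      volume (ball (0 : Euc d) 1) * ((volume (ball x₀ r))⁻¹ * ∫⁻ y, f y) := by
  rw [lintegral_avgMeasure, lintegral_lintegral_swap]
  · calc _ ≤ (volume (ball x₀ r))⁻¹ * ∫⁻ z in ball (0 : Euc d) 1, ∫⁻ y, f y := by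
          refine mul_le_mul' le_rfl (lintegral_mono fun z => ?_)
          refine (setLIntegral_le_lintegral _ _).trans (le_of_eq ?_)
          exact lintegral_add_right_eq_self (fun y => f y) _
      _ = _ := by rw [setLIntegral_const]; ring
  · exact (hf.comp (f := fun q : Euc d × Euc d => q.1 + (r * s) • q.2) (by fun_prop)).aemeasurable

lemma lintegral_rpow_mul_le {α : Type*} [MeasurableSpace α] {μ : Measure α} {w g : α → ℝ≥0∞}
    (hw : AEMeasurable w μ) (hg : AEMeasurable g μ) (hw' : ∀ᵐ x ∂μ, w x ≠ 0 ∧ w x ≠ ∞)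
    {b : ℝ} (hb : 0 ≤ b) (hb1 : b ≤ 1) :
    ∫⁻ x, w x * g x ^ b ∂μ ≤ (∫⁻ x, w x ∂μ) ^ (1 - b) * (∫⁻ x, w x * g x ∂μ) ^ b := by
  refine le_trans (le_of_eq (lintegral_congr_ae ?_)) (ENNReal.lintegral_mul_norm_pow_le hw
    (hw.mul hg) (sub_nonneg.2 hb1) hb (by ring))
  filter_upwards [hw'] with x hx
  simp only [Pi.mul_apply]
  rw [ENNReal.mul_rpow_of_nonneg _ _ hb, ← mul_assoc, ← ENNReal.rpow_add _ _ hx.1 hx.2,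
    sub_add_cancel, ENNReal.rpow_one]

lemma lintegral_Ioo_rpow_ne_top {γ : ℝ} (hγ : -1 < γ) :
    ∫⁻ s in Ioo (0 : ℝ) (1 / 2), ENNReal.ofReal (s ^ γ) ≠ ∞ := by
  have h : IntegrableOn (fun s : ℝ => s ^ γ) (Ioc 0 (1 / 2)) :=
    (intervalIntegrable_iff_integrableOn_Ioc_of_le (by norm_num)).1
      (intervalIntegral.intervalIntegrable_rpow' hγ)
  exact ((h.mono_set Ioo_subset_Ioc_self).lintegral_lt_top).ne

lemma ballPotential_le (hf : Measurable f) {a b : ℝ} (ha : 0 < a) (ha1 : a ≤ 1) (hba : b ≤ a)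
    (hb : 0 ≤ b) (x₀ : Euc d) {r : ℝ} (hr : 0 < r) (x : Euc d) :
    ballPotential r f x ≤ volume (ball (0 : Euc d) 1) ^ (1 - b) *
      ((volume (ball x₀ r))⁻¹ * ∫⁻ y, f y ^ a⁻¹) ^ (a - b) *
      ((∫⁻ s in Ioo (0 : ℝ) (1 / 2), ENNReal.ofReal (s ^ (1 - d * (a - b)))) ^ (1 - b) *
        (∫⁻ s in Ioo (0 : ℝ) (1 / 2), ENNReal.ofReal (s ^ (1 - d * (a - b))) *
          ∫⁻ z in ball (0 : Euc d) 1, f (x + (r * s) • z) ^ a⁻¹) ^ b) := by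
  set β := volume (ball (0 : Euc d) 1) with hβdef
  have hβ : β ≠ 0 := volume_ball_ne_zero (0 : Euc d) one_pos
  have hβ' : β ≠ ∞ := volume_ball_ne_top (0 : Euc d) 1
  set E := (volume (ball x₀ r))⁻¹ * ∫⁻ y, f y ^ a⁻¹
  set P : ℝ → ℝ≥0∞ := fun s => ∫⁻ z in ball (0 : Euc d) 1, f (x + (r * s) • z) ^ a⁻¹ with hP
  have hPm : Measurable P := by
    have := measurable_ball_lintegral (hf.pow_const a⁻¹) r
    exact this.comp (measurable_prodMk_left (x := x))
  have hin : ∀ s ∈ Ioo (0 : ℝ) (1 / 2), ENNReal.ofReal s *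
      ∫⁻ z in ball (0 : Euc d) 1, f (x + (r * s) • z) ≤
      β ^ (1 - b) * E ^ (a - b) * (ENNReal.ofReal (s ^ (1 - d * (a - b))) * P s ^ b) := by
    intro s hs
    have h1 : ∫⁻ z in ball (0 : Euc d) 1, f (x + (r * s) • z) ≤ β ^ (1 - a) * P s ^ a := by
      have := lintegral_rpow_mul_le (μ := volume.restrict (ball (0 : Euc d) 1)) (w := fun _ => 1)
        (g := fun z => f (x + (r * s) • z) ^ a⁻¹) aemeasurable_const
        ((hf.comp (by fun_prop : Measurable fun z : Euc d => x + (r * s) • z)).pow_const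
          _).aemeasurable (by simp) ha.le ha1
      simpa [← ENNReal.rpow_mul, inv_mul_cancel₀ ha.ne', hP, hβdef] using this
    have h2 : P s ≤ ENNReal.ofReal (s ^ (-(d : ℝ))) * (β * E) :=
      ball_lintegral_le (fun y => f y ^ a⁻¹) x₀ x hr hs.1
    have hab : 0 ≤ a - b := sub_nonneg.2 hba
    have h3 : P s ^ a ≤ ENNReal.ofReal (s ^ (-(d * (a - b)))) *
        (β ^ (a - b) * E ^ (a - b)) * P s ^ b := by
      have : P s ^ a = P s ^ (a - b) * P s ^ b := by
        rw [← ENNReal.rpow_add_of_nonneg _ _ hab hb, sub_add_cancel]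
      rw [this]
      gcongr
      refine (ENNReal.rpow_le_rpow h2 hab).trans (le_of_eq ?_)
      rw [ENNReal.mul_rpow_of_nonneg _ _ hab, ENNReal.mul_rpow_of_nonneg _ _ hab,
        ENNReal.ofReal_rpow_of_pos (Real.rpow_pos_of_pos hs.1 _), ← Real.rpow_mul hs.1.le, neg_mul]
    have h4 : ENNReal.ofReal (s ^ (1 - d * (a - b))) =
        ENNReal.ofReal s * ENNReal.ofReal (s ^ (-(d * (a - b)))) := by
      rw [← ENNReal.ofReal_mul hs.1.le, sub_eq_add_neg, Real.rpow_add hs.1, Real.rpow_one]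
    have h5 : β ^ (1 - b) = β ^ (1 - a) * β ^ (a - b) := by
      rw [← ENNReal.rpow_add _ _ hβ hβ']; congr 1; ring
    rw [h4, h5]
    calc _ ≤ ENNReal.ofReal s * (β ^ (1 - a) * (ENNReal.ofReal (s ^ (-(d * (a - b)))) *
        (β ^ (a - b) * E ^ (a - b)) * P s ^ b)) := by
          gcongr
          exact h1.trans (by gcongr)
      _ = _ := by ring
  have hwm : Measurable fun s : ℝ => ENNReal.ofReal (s ^ (1 - d * (a - b))) := by fun_prop
  calc ballPotential r f x
      ≤ ∫⁻ s in Ioo (0 : ℝ) (1 / 2), β ^ (1 - b) * E ^ (a - b) *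
          (ENNReal.ofReal (s ^ (1 - d * (a - b))) * P s ^ b) :=
        setLIntegral_mono' measurableSet_Ioo hin
    _ = β ^ (1 - b) * E ^ (a - b) * ∫⁻ s in Ioo (0 : ℝ) (1 / 2),
          ENNReal.ofReal (s ^ (1 - d * (a - b))) * P s ^ b :=
        lintegral_const_mul _ (hwm.mul (hPm.pow_const _))
    _ ≤ _ := by
        gcongr
        refine lintegral_rpow_mul_le hwm.aemeasurable hPm.aemeasurable ?_ hb (hba.trans ha1)
        filter_upwards [ae_restrict_mem measurableSet_Ioo] with s hs
        exact ⟨by simpa using Real.rpow_pos_of_pos hs.1 _, ENNReal.ofReal_ne_top⟩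

lemma eLpNorm_ballPotential_le {p q : ℝ≥0∞} (hp : 1 ≤ p) (hpq : p < q)
    (hgap : (d : ℝ) * (p⁻¹.toReal - q⁻¹.toReal) < 2) :
    ∃ C : ℝ≥0∞, C ≠ ∞ ∧ ∀ (x₀ : Euc d) (r : ℝ), 0 < r → ∀ f : Euc d → ℝ≥0∞, Measurable f →
      eLpNorm (ballPotential r f) q (avgMeasure x₀ r) ≤
        C * ((volume (ball x₀ r))⁻¹ * ∫⁻ y, f y ^ p.toReal) ^ p⁻¹.toReal := by
  have hp0 : p ≠ 0 := (zero_lt_one.trans_le hp).ne'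
  have hpt : p ≠ ∞ := hpq.ne_top
  have hinv : q⁻¹ ≤ p⁻¹ := ENNReal.inv_le_inv.2 hpq.le
  set a := p⁻¹.toReal with ha_def
  set b := q⁻¹.toReal with hb_def
  have ha : 0 < a := ENNReal.toReal_pos (by simpa using hpt) (by simpa using hp0)
  have ha1 : a ≤ 1 := ENNReal.toReal_le_of_le_ofReal zero_le_one (by simpa using hp)
  have hba : b ≤ a := ENNReal.toReal_mono (by simpa using hp0) hinv
  have hb : 0 ≤ b := ENNReal.toReal_nonneg
  have hpa : p.toReal = a⁻¹ := by rw [ha_def, ENNReal.toReal_inv, inv_inv]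
  rw [hpa]
  set m := ∫⁻ s in Ioo (0 : ℝ) (1 / 2), ENNReal.ofReal (s ^ (1 - d * (a - b))) with hm_def
  have hm : m ≠ ∞ := lintegral_Ioo_rpow_ne_top (by linarith)
  set β := volume (ball (0 : Euc d) 1) with hβdef
  have hβ' : β ≠ ∞ := volume_ball_ne_top (0 : Euc d) 1
  have hb1 : 0 ≤ 1 - b := by linarith
  refine ⟨β ^ (1 - b) * (m ^ (1 - b) * (m * β) ^ b), ?_, ?_⟩
  · exact ENNReal.mul_ne_top (ENNReal.rpow_ne_top_of_nonneg hb1 hβ')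
      (ENNReal.mul_ne_top (ENNReal.rpow_ne_top_of_nonneg hb1 hm)
        (ENNReal.rpow_ne_top_of_nonneg hb (ENNReal.mul_ne_top hm hβ')))
  intro x₀ r hr f hf
  have := isProbabilityMeasure_avgMeasure x₀ hr
  set E := (volume (ball x₀ r))⁻¹ * ∫⁻ y, f y ^ a⁻¹ with hE
  have hEa : E ^ a = E ^ (a - b) * E ^ b := by
    rw [← ENNReal.rpow_add_of_nonneg _ _ (sub_nonneg.2 hba) hb, sub_add_cancel]
  set Q : Euc d → ℝ≥0∞ := fun x => ∫⁻ s in Ioo (0 : ℝ) (1 / 2),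
    ENNReal.ofReal (s ^ (1 - d * (a - b))) *
      ∫⁻ z in ball (0 : Euc d) 1, f (x + (r * s) • z) ^ a⁻¹ with hQ
  have hpt : ∀ x, ballPotential r f x ≤ β ^ (1 - b) * E ^ (a - b) * (m ^ (1 - b) * Q x ^ b) :=
    fun x => ballPotential_le hf ha ha1 hba hb x₀ hr x
  have hPm := measurable_ball_lintegral (hf.pow_const a⁻¹) r
  have hjm : Measurable fun q : Euc d × ℝ => ENNReal.ofReal (q.2 ^ (1 - d * (a - b))) *
      ∫⁻ z in ball (0 : Euc d) 1, f (q.1 + (r * q.2) • z) ^ a⁻¹ := by fun_prop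
  have hQm : Measurable Q := hjm.lintegral_prod_right'
  have hQint : ∫⁻ x, Q x ∂(avgMeasure x₀ r) ≤ m * β * E := by
    rw [hQ, lintegral_lintegral_swap hjm.aemeasurable]
    calc _ ≤ ∫⁻ s in Ioo (0 : ℝ) (1 / 2), ENNReal.ofReal (s ^ (1 - d * (a - b))) * (β * E) := by
          refine lintegral_mono fun s => ?_
          have hPs : Measurable fun x : Euc d =>
              ∫⁻ z in ball (0 : Euc d) 1, f (x + (r * s) • z) ^ a⁻¹ :=
            hPm.comp (measurable_prodMk_right (y := s))
          rw [lintegral_const_mul _ hPs]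
          gcongr
          exact lintegral_ball_lintegral_le (hf.pow_const a⁻¹) x₀ r s
      _ = _ := by
          rw [lintegral_mul_const _ (by fun_prop), mul_assoc]
  have hQb : eLpNorm (fun x => Q x ^ b) q (avgMeasure x₀ r) ≤ (m * β * E) ^ b := by
    rcases eq_or_ne q ∞ with rfl | hq
    · have hb0 : b = 0 := by simp [hb_def]
      simp only [hb0, ENNReal.rpow_zero]
      rw [eLpNorm_const _ (by simp) (NeZero.ne _)]
      simp
    · have hq0 : q ≠ 0 := (zero_le.trans_lt hpq).ne'
      have hb0 : b ≠ 0 := (ENNReal.toReal_pos (by simpa using hq) (by simpa using hq0)).ne'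
      have hqb : q.toReal = b⁻¹ := by rw [hb_def, ENNReal.toReal_inv, inv_inv]
      rw [eLpNorm_eq_lintegral_rpow_enorm_toReal hq0 hq, hqb]
      simp only [enorm_eq_self, one_div, inv_inv]
      gcongr
      refine le_trans (le_of_eq ?_) hQint
      simp [← ENNReal.rpow_mul, hb0]
  calc eLpNorm (ballPotential r f) q (avgMeasure x₀ r)
      ≤ (β ^ (1 - b) * E ^ (a - b) * m ^ (1 - b)) *
          eLpNorm (fun x => Q x ^ b) q (avgMeasure x₀ r) :=
        eLpNorm_le_mul_eLpNorm_of_ae_le_mul'' q (hQm.pow_const b).aestronglyMeasurable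
          (Filter.Eventually.of_forall fun x => by simpa [mul_assoc] using hpt x)
    _ ≤ (β ^ (1 - b) * E ^ (a - b) * m ^ (1 - b)) * (m * β * E) ^ b := by gcongr
    _ = _ := by rw [hEa, ENNReal.mul_rpow_of_nonneg _ _ hb]; ring

end Potential

lemma ofReal_integral_le_lintegral_ofReal {α : Type*} [MeasurableSpace α] {μ : Measure α}
    (g : α → ℝ) : ENNReal.ofReal (∫ x, g x ∂μ) ≤ ∫⁻ x, ENNReal.ofReal (g x) ∂μ := by
  by_cases hg : Integrable g μ
  · rw [integral_eq_lintegral_pos_part_sub_lintegral_neg_part hg]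
    exact (ENNReal.ofReal_le_ofReal (sub_le_self _ ENNReal.toReal_nonneg)).trans
      ENNReal.ofReal_toReal_le
  · simp [integral_undef hg]

lemma lintegral_ofReal_mul_le {d : ℕ} {k g : Euc d → ℝ} {G : Euc d → ℝ≥0∞} {M : ℝ}
    (hk0 : ∀ z, 0 ≤ k z) (hkM : ∀ z, k z ≤ M) (hk : ∀ z, z ∉ ball (0 : Euc d) 1 → k z = 0)
    (hg : ∀ z ∈ ball (0 : Euc d) 1, ENNReal.ofReal (g z) ≤ G z) :
    ENNReal.ofReal (∫ z, k z * g z) ≤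
      ∫⁻ z in ball (0 : Euc d) 1, ENNReal.ofReal M * G z := by
  refine (ofReal_integral_le_lintegral_ofReal _).trans ?_
  rw [← lintegral_indicator measurableSet_ball]
  refine lintegral_mono fun z => ?_
  by_cases hz : z ∈ ball (0 : Euc d) 1
  · rw [indicator_of_mem hz, ENNReal.ofReal_mul (hk0 z)]
    exact mul_le_mul' (ENNReal.ofReal_le_ofReal (hkM z)) (hg z hz)
  · simp [indicator_of_notMem hz, hk z hz]

lemma integral_radialKerDeriv_pos {d : ℕ} : 0 < ∫ z : Euc d, radialKerDeriv z := by
  refine continuous_radialKerDeriv.integral_pos_of_hasCompactSupport_nonneg_nonzero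
    (hasCompactSupport_of_eq_zero fun z hz => radialKerDeriv_eq_zero hz) radialKerDeriv_nonneg
    (x := 0) ?_
  simp [radialKerDeriv]

/-- Mean value inequality for a function whose Laplacian is bounded below by `-G`. -/
lemma ofReal_mul_le_of_laplacian_le {d : ℕ} {W : Euc d → ℝ} (hW : ContDiff ℝ 2 W) {x : Euc d}
    {r : ℝ} (hr : 0 < r) {G H : Euc d → ℝ≥0∞} (hG : ∀ y ∈ ball x (r / 2),
      ENNReal.ofReal (-∑ j, pd (pd W j) j y) ≤ G y)
    (hH : ∀ y ∈ ball x (r / 2), ENNReal.ofReal (W y) ≤ H y) :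
    ENNReal.ofReal (W x) * ENNReal.ofReal (∫ z : Euc d, radialKerDeriv z) ≤
      4 * (ENNReal.ofReal ((r / 2) ^ d))⁻¹ * (∫⁻ y, H y) +
        ENNReal.ofReal (r ^ 2) * ballPotential r G x := by
  have hmem : ∀ s ∈ Ioc (0 : ℝ) (1 / 2), ∀ z ∈ ball (0 : Euc d) 1,
      x + (r * s) • z ∈ ball x (r / 2) := by
    intro s hs z hz
    have h1 : ‖z‖ < 1 := by simpa using hz
    have h0 := mul_pos hr hs.1
    simp only [mem_ball, dist_self_add_left, norm_smul, Real.norm_eq_abs, abs_of_pos h0]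
    nlinarith [norm_nonneg z, hs.2]
  have hKW : Integrable fun z : Euc d => radialKerDeriv z * W (x + (r * (1 / 2)) • z) := by
    refine Continuous.integrable_of_hasCompactSupport ?_
      (hasCompactSupport_of_eq_zero fun z hz => by simp [radialKerDeriv_eq_zero hz])
    have := continuous_radialKerDeriv (d := d)
    have := hW.continuous
    fun_prop
  have hK : Integrable fun z : Euc d => radialKerDeriv z :=
    continuous_radialKerDeriv.integrable_of_hasCompactSupport
      (hasCompactSupport_of_eq_zero fun z hz => radialKerDeriv_eq_zero hz)
  have hrep := integral_radialKerDeriv_mul_sub hW x r (1 / 2)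
  simp only [mul_sub] at hrep
  rw [integral_sub hKW (hK.mul_const _), integral_mul_const] at hrep
  have hid : W x * ∫ z : Euc d, radialKerDeriv z =
      (∫ z : Euc d, radialKerDeriv z * W (x + (r * (1 / 2)) • z)) +
      r ^ 2 * ∫ s in Ioc (0 : ℝ) (1 / 2),
        s * ∫ z, radialKer z * -∑ j, pd (pd W j) j (x + (r * s) • z) := by
    rw [intervalIntegral.integral_of_le (by norm_num)] at hrep
    simp only [mul_neg, integral_neg]
    linarith
  rw [← ENNReal.ofReal_mul' integral_radialKerDeriv_pos.le, hid]
  refine ENNReal.ofReal_add_le.trans (add_le_add ?_ ?_)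
  · refine (lintegral_ofReal_mul_le radialKerDeriv_nonneg radialKerDeriv_le
      (fun z hz => radialKerDeriv_eq_zero hz) (G := fun z => H (x + (r * (1 / 2)) • z))
      fun z hz => hH _ (hmem _ (by norm_num) z hz)).trans ?_
    rw [lintegral_const_mul' _ _ ENNReal.ofReal_ne_top, ENNReal.ofReal_ofNat, mul_assoc]
    gcongr
    rw [mul_one_div]
    exact lintegral_ball_comp_le H x (half_pos hr)
  · rw [ENNReal.ofReal_mul (by positivity)]
    gcongr
    refine (ofReal_integral_le_lintegral_ofReal _).trans ?_
    rw [ballPotential, restrict_Ioo_eq_restrict_Ioc]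
    refine setLIntegral_mono' measurableSet_Ioc fun s hs => ?_
    rw [ENNReal.ofReal_mul hs.1.le]
    gcongr
    refine (lintegral_ofReal_mul_le radialKer_nonneg radialKer_le_one
      (fun z hz => radialKer_eq_zero hz) (G := fun z => G (x + (r * s) • z))
      fun z hz => hG _ (hmem s hs z hz)).trans ?_
    simp

lemma exists_contDiff_cutoff_regAbs {d : ℕ} {x₀ : Euc d} {r : ℝ} (hr : 0 < r) {u : Euc d → ℂ}
    (hu : ContDiffOn ℝ 2 u (ball x₀ (2 * r))) {ε : ℝ} (hε : 0 < ε) :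
    ∃ W : Euc d → ℝ, ContDiff ℝ 2 W ∧ ∀ y ∈ ball x₀ (3 / 2 * r), W =ᶠ[nhds y] regAbs u ε := by
  let χ : ContDiffBump x₀ := ⟨3 / 2 * r, 7 / 4 * r, by positivity, by linarith⟩
  refine ⟨fun y => χ y * regAbs u ε y, contDiff_iff_contDiffAt.2 fun y => ?_, fun y hy => ?_⟩
  · by_cases hy : y ∈ ball x₀ (2 * r)
    · exact χ.contDiff.contDiffAt.mul
        (contDiffAt_regAbs hε (hu.contDiffAt (isOpen_ball.mem_nhds hy)))
    · have hy' : y ∉ tsupport χ := by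
        rw [χ.tsupport_eq]
        intro h
        refine hy (mem_ball.2 ((mem_closedBall.1 h).trans_lt ?_))
        change 7 / 4 * r < 2 * r
        linarith
      refine (contDiffAt_const (c := (0 : ℝ))).congr_of_eventuallyEq ?_
      filter_upwards [notMem_tsupport_iff_eventuallyEq.1 hy'] with z hz
      simp [hz]
  · filter_upwards [isOpen_ball.mem_nhds hy] with z hz
    rw [χ.one_of_mem_closedBall (ball_subset_closedBall hz), one_mul]

lemma ofReal_neg_le_enorm {d : ℕ} {A : Euc d → Fin d → ℝ} {u : Euc d → ℂ} {ε : ℝ} (hε : 0 < ε)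
    {x : Euc d} (hA : ContDiffAt ℝ 1 A x) (hu : ContDiffAt ℝ 2 u x) {W : Euc d → ℝ}
    (hW : W =ᶠ[nhds x] regAbs u ε) :
    ENNReal.ofReal (-∑ j, pd (pd W j) j x) ≤ ‖magLap A u x‖ₑ := by
  have h : ∀ j, pd (pd W j) j x = pd (pd (regAbs u ε) j) j x := fun j =>
    pd_congr (hW.eventuallyEq_nhds.mono fun y hy => pd_congr hy j) j
  simp only [h]
  rw [← ofReal_norm]
  exact ENNReal.ofReal_le_ofReal (neg_le.1 (neg_norm_magLap_le hε hA hu))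

/-- Pointwise interior bound by the mean value and the potential of the source term. -/
lemma enorm_mul_le {d : ℕ} {x₀ x : Euc d} {r : ℝ} (hr : 0 < r) (hx : x ∈ ball x₀ r)
    {A : Euc d → Fin d → ℝ} (hA : ContDiffOn ℝ 1 A (ball x₀ (2 * r)))
    {u : Euc d → ℂ} (hu : ContDiffOn ℝ 2 u (ball x₀ (2 * r))) :
    ‖u x‖ₑ * ENNReal.ofReal (∫ z : Euc d, radialKerDeriv z) ≤
      4 ^ (d + 1) * volume (ball (0 : Euc d) 1) * eLpNorm u 1 (avgMeasure x₀ (2 * r)) +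
        ENNReal.ofReal (r ^ 2) * ballPotential r
          ((ball x₀ (2 * r)).indicator fun y => ‖magLap A u y‖ₑ) x := by
  have h2r : 0 < 2 * r := by positivity
  have := isProbabilityMeasure_avgMeasure x₀ h2r
  have hβ' := volume_ball_ne_top (0 : Euc d) 1
  have hsub : ball x (r / 2) ⊆ ball x₀ (3 / 2 * r) :=
    ball_subset_ball' (by linarith [mem_ball.1 hx])
  have hsub' : ball x₀ (3 / 2 * r) ⊆ ball x₀ (2 * r) := ball_subset_ball (by linarith)
  have key : ∀ ε : ℝ, 0 < ε → ‖u x‖ₑ * ENNReal.ofReal (∫ z : Euc d, radialKerDeriv z) ≤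
      4 ^ (d + 1) * volume (ball (0 : Euc d) 1) *
        (eLpNorm u 1 (avgMeasure x₀ (2 * r)) + ENNReal.ofReal ε) +
        ENNReal.ofReal (r ^ 2) * ballPotential r
          ((ball x₀ (2 * r)).indicator fun y => ‖magLap A u y‖ₑ) x := by
    intro ε hε
    obtain ⟨W, hW, hWu⟩ := exists_contDiff_cutoff_regAbs hr hu hε
    have h := ofReal_mul_le_of_laplacian_le hW (x := x) hr
      (G := (ball x₀ (2 * r)).indicator fun y => ‖magLap A u y‖ₑ)
      (H := (ball x₀ (2 * r)).indicator fun y => ‖u y‖ₑ + ENNReal.ofReal ε)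
      (fun y hy => by
        have hy' := hsub' (hsub hy)
        have hn := isOpen_ball.mem_nhds hy'
        rw [indicator_of_mem hy']
        exact ofReal_neg_le_enorm hε (hA.contDiffAt hn) (hu.contDiffAt hn) (hWu y (hsub hy)))
      (fun y hy => by
        rw [indicator_of_mem (hsub' (hsub hy)), (hWu y (hsub hy)).self_of_nhds,
          ← ofReal_norm, ← ENNReal.ofReal_add (norm_nonneg _) hε.le]
        exact ENNReal.ofReal_le_ofReal (regAbs_le u hε y))
    have hux : ‖u x‖ₑ ≤ ENNReal.ofReal (W x) := by
      rw [(hWu x (hsub (mem_ball_self (half_pos hr)))).self_of_nhds, ← ofReal_norm]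
      exact ENNReal.ofReal_le_ofReal (norm_le_regAbs u ε x)
    refine (mul_le_mul' hux le_rfl).trans (h.trans (add_le_add (le_of_eq ?_) le_rfl))
    have havg : eLpNorm u 1 (avgMeasure x₀ (2 * r)) + ENNReal.ofReal ε =
        (volume (ball x₀ (2 * r)))⁻¹ * ∫⁻ y in ball x₀ (2 * r), (‖u y‖ₑ + ENNReal.ofReal ε) := by
      rw [← lintegral_avgMeasure, lintegral_add_right _ measurable_const, lintegral_const,
        measure_univ, mul_one, eLpNorm_one_eq_lintegral_enorm]
    rw [havg, lintegral_indicator measurableSet_ball, ← mul_assoc]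
    congr 1
    have hr4 : (2 * r) ^ d = 4 ^ d * (r / 2) ^ d := by rw [← mul_pow]; ring
    rw [volume_ball_eq x₀ h2r, hr4, ENNReal.ofReal_mul (by positivity),
      ENNReal.ofReal_pow (p := (4 : ℝ)) (by norm_num), ENNReal.ofReal_ofNat]
    have hβ := volume_ball_ne_zero (0 : Euc d) one_pos
    have h4 : (4 : ℝ≥0∞) ^ d ≠ 0 := by simp
    have h4' : (4 : ℝ≥0∞) ^ d ≠ ∞ := by finiteness
    rw [ENNReal.mul_inv (.inr hβ') (.inr hβ), ENNReal.mul_inv (.inl h4) (.inl h4'), pow_succ]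
    calc _ = (4 ^ d * (4 ^ d)⁻¹) * (volume (ball (0 : Euc d) 1) * (volume (ball (0 : Euc d) 1))⁻¹)
          * (4 * (ENNReal.ofReal ((r / 2) ^ d))⁻¹) := by
          rw [ENNReal.mul_inv_cancel h4 h4', ENNReal.mul_inv_cancel hβ hβ', one_mul, one_mul]
      _ = _ := by ring
  have hK : (4 : ℝ≥0∞) ^ (d + 1) * volume (ball (0 : Euc d) 1) ≠ ∞ := by finiteness
  have hlim : Filter.Tendsto (fun ε : ℝ => 4 ^ (d + 1) * volume (ball (0 : Euc d) 1) *
        (eLpNorm u 1 (avgMeasure x₀ (2 * r)) + ENNReal.ofReal ε) +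
        ENNReal.ofReal (r ^ 2) * ballPotential r
          ((ball x₀ (2 * r)).indicator fun y => ‖magLap A u y‖ₑ) x)
      (nhdsWithin 0 (Ioi 0)) (nhds (4 ^ (d + 1) * volume (ball (0 : Euc d) 1) *
        (eLpNorm u 1 (avgMeasure x₀ (2 * r)) + ENNReal.ofReal 0) +
        ENNReal.ofReal (r ^ 2) * ballPotential r
          ((ball x₀ (2 * r)).indicator fun y => ‖magLap A u y‖ₑ) x)) := by
    refine (ENNReal.Tendsto.const_mul ((ENNReal.continuous_ofReal.tendsto 0).const_add _)
      (.inr hK)).add_const _ |>.mono_left nhdsWithin_le_nhds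
  have := ge_of_tendsto hlim (eventually_nhdsWithin_of_forall fun ε hε => key ε hε)
  simpa using this

lemma continuousOn_magLap {d : ℕ} {U : Set (Euc d)} (hU : IsOpen U)
    {A : Euc d → Fin d → ℝ} (hA : ContDiffOn ℝ 1 A U) {u : Euc d → ℂ} (hu : ContDiffOn ℝ 2 u U) :
    ContinuousOn (magLap A u) U := by
  refine continuousOn_finsetSum _ fun j _ => ContinuousOn.congr (f := fun x =>
      -pd (pd u j) j x - Complex.I * (pd (fun y => A y j) j x : ℝ) * u x
        - 2 * Complex.I * A x j * pd u j x + (A x j : ℂ) ^ 2 * u x)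
    (fun x hx => ContinuousAt.continuousWithinAt ?_) fun x hx =>
      mOp_mOp (hA.contDiffAt (hU.mem_nhds hx)) (hu.contDiffAt (hU.mem_nhds hx)) j
  have hAx := contDiffAt_pi.1 (hA.contDiffAt (hU.mem_nhds hx)) j
  have hux := hu.contDiffAt (hU.mem_nhds hx)
  have hu1 := contDiffAt_pd (m := 1) hux (by norm_num [one_add_one_eq_two]) j
  have c1 := (contDiffAt_pd (m := 0) hu1 (by norm_num) j).continuousAt
  have c2 := (contDiffAt_pd (m := 0) hAx (by norm_num) j).continuousAt
  have c3 := hu1.continuousAt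
  have c4 := hux.continuousAt
  have c5 := hAx.continuousAt
  have c2' : ContinuousAt (fun x => ((pd (fun y => A y j) j x : ℝ) : ℂ)) x :=
    Complex.continuous_ofReal.continuousAt.comp c2
  have c5' : ContinuousAt (fun x => (A x j : ℂ)) x :=
    Complex.continuous_ofReal.continuousAt.comp c5
  fun_prop

lemma measurable_indicator_enorm_magLap {d : ℕ} {U : Set (Euc d)} (hU : IsOpen U)
    {A : Euc d → Fin d → ℝ} (hA : ContDiffOn ℝ 1 A U) {u : Euc d → ℂ} (hu : ContDiffOn ℝ 2 u U) :
    Measurable (U.indicator fun y => ‖magLap A u y‖ₑ) := by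
  classical
  rw [← piecewise_eq_indicator]
  exact (continuousOn_magLap hU hA hu).enorm.measurable_piecewise continuousOn_const
    hU.measurableSet

lemma rpow_lintegral_indicator_eq {d : ℕ} (x₀ : Euc d) {r : ℝ} (hr : 0 < r) {p : ℝ≥0∞}
    (hp0 : p ≠ 0) (hpt : p ≠ ∞) (F : Euc d → ℂ) :
    ((volume (ball x₀ r))⁻¹ *
      ∫⁻ y, (ball x₀ (2 * r)).indicator (fun y => ‖F y‖ₑ) y ^ p.toReal) ^ p⁻¹.toReal =
      ((2 : ℝ≥0∞) ^ d) ^ p⁻¹.toReal * eLpNorm F p (avgMeasure x₀ (2 * r)) := by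
  have hp : 0 < p.toReal := ENNReal.toReal_pos hp0 hpt
  have hind : ∀ y, (ball x₀ (2 * r)).indicator (fun y => ‖F y‖ₑ) y ^ p.toReal =
      (ball x₀ (2 * r)).indicator (fun y => ‖F y‖ₑ ^ p.toReal) y := fun y => by
    by_cases hy : y ∈ ball x₀ (2 * r)
    · simp only [indicator_of_mem hy]
    · simp only [indicator_of_notMem hy, ENNReal.zero_rpow_of_pos hp]
  have h2 : (2 : ℝ≥0∞) ^ d ≠ 0 := by simp
  have h2' : (2 : ℝ≥0∞) ^ d ≠ ∞ := by finiteness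
  have hV := volume_ball_ne_zero x₀ hr
  have hV' := volume_ball_ne_top x₀ r
  have hvol : (volume (ball x₀ r))⁻¹ = 2 ^ d * (volume (ball x₀ (2 * r)))⁻¹ := by
    have : volume (ball x₀ (2 * r)) = 2 ^ d * volume (ball x₀ r) := by
      rw [volume_ball_eq x₀ (by positivity), volume_ball_eq x₀ hr, mul_pow,
        ENNReal.ofReal_mul (by positivity), ENNReal.ofReal_pow (by norm_num),
        ENNReal.ofReal_ofNat, mul_assoc]
    rw [this, ENNReal.mul_inv (.inl h2) (.inl h2'), ← mul_assoc, ENNReal.mul_inv_cancel h2 h2',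
      one_mul]
  simp only [hind]
  rw [lintegral_indicator measurableSet_ball, hvol, mul_assoc, ← lintegral_avgMeasure,
    ENNReal.mul_rpow_of_nonneg _ _ ENNReal.toReal_nonneg,
    eLpNorm_eq_lintegral_rpow_enorm_toReal hp0 hpt, ENNReal.toReal_inv, one_div]

lemma natCast_mul_sub_lt_two {d : ℕ} {p q : ℝ≥0∞} (hp0 : p ≠ 0) (hpq : p < q)
    (hgap : 1 / p - 1 / q < 2 / (d : ℝ≥0∞)) : (d : ℝ) * (p⁻¹.toReal - q⁻¹.toReal) < 2 := by
  rcases Nat.eq_zero_or_pos d with rfl | hd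
  · simp
  · have hd0 : (d : ℝ≥0∞) ≠ 0 := by simpa using hd.ne'
    have hfin : (2 / (d : ℝ≥0∞)) ≠ ∞ := ENNReal.div_ne_top (by simp) hd0
    have hlt := ENNReal.toReal_strict_mono hfin hgap
    rw [one_div, one_div, ENNReal.toReal_sub_of_le (ENNReal.inv_le_inv.2 hpq.le)
      (by simpa using hp0), ENNReal.toReal_div, ENNReal.toReal_ofNat, ENNReal.toReal_natCast,
      lt_div_iff₀ (by positivity)] at hlt
    linarith

/-- interior `L^q`–`L^p` estimate.  Let `A ∈ C¹(𝓑(x₀,2r); ℝ^d)` and let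
`u ∈ C²(𝓑(x₀,2r); ℂ)` satisfy `(D+A)²u = F` in `𝓑(x₀,2r)`.  If `2 ≤ p < q ≤ ∞` and
`1/p − 1/q < 2/d`, then `(⨍_{𝓑(x₀,r)} |u|^q)^{1/q} ≤ C ⨍_{𝓑(x₀,2r)} |u| +
C r² (⨍_{𝓑(x₀,2r)} |F|^p)^{1/p}`, with `C` depending only on `d`, `p`, `q`. -/
theorem stmt_5 {d : ℕ} (p q : ℝ≥0∞) (hp : 2 ≤ p) (hpq : p < q)
    (hgap : 1 / p - 1 / q < 2 / (d : ℝ≥0∞)) :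
    ∃ C > (0 : ℝ), ∀ (x₀ : Euc d) (r : ℝ), 0 < r →
      ∀ (A : Euc d → Fin d → ℝ), ContDiffOn ℝ 1 A (ball x₀ (2 * r)) →
      ∀ (u : Euc d → ℂ), ContDiffOn ℝ 2 u (ball x₀ (2 * r)) →
      ∀ F : Euc d → ℂ, (∀ x ∈ ball x₀ (2 * r), magLap A u x = F x) →
        eLpNorm u q (avgMeasure x₀ r) ≤
          ENNReal.ofReal C * eLpNorm u 1 (avgMeasure x₀ (2 * r)) +
            ENNReal.ofReal (C * r ^ 2) * eLpNorm F p (avgMeasure x₀ (2 * r)) := by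
  have hp1 : 1 ≤ p := one_le_two.trans hp
  have hp0 : p ≠ 0 := (zero_lt_one.trans_le hp1).ne'
  have hpt : p ≠ ∞ := hpq.ne_top
  obtain ⟨Cp, hCp, hpot⟩ :=
    eLpNorm_ballPotential_le hp1 hpq (natCast_mul_sub_lt_two hp0 hpq hgap)
  set κ := ENNReal.ofReal (∫ z : Euc d, radialKerDeriv z) with hκ_def
  have hκ : κ ≠ 0 := by simpa [hκ_def] using integral_radialKerDeriv_pos
  have hκ' : κ ≠ ∞ := ENNReal.ofReal_ne_top
  have hβ' := volume_ball_ne_top (0 : Euc d) 1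
  set C₁ : ℝ≥0∞ := κ⁻¹ * (4 ^ (d + 1) * volume (ball (0 : Euc d) 1)) with hC₁_def
  set C₂ : ℝ≥0∞ := κ⁻¹ * (Cp * (2 ^ d) ^ p⁻¹.toReal) with hC₂_def
  have hκi : κ⁻¹ ≠ ∞ := by simpa using hκ
  have hC₁ : C₁ ≠ ∞ := by finiteness
  have hC₂ : C₂ ≠ ∞ := ENNReal.mul_ne_top hκi (ENNReal.mul_ne_top hCp
    (ENNReal.rpow_ne_top_of_nonneg ENNReal.toReal_nonneg (by finiteness)))
  refine ⟨C₁.toReal + C₂.toReal + 1, by positivity, ?_⟩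
  intro x₀ r hr A hA u hu F hF
  have := isProbabilityMeasure_avgMeasure x₀ hr
  set h := ballPotential r ((ball x₀ (2 * r)).indicator fun y => ‖magLap A u y‖ₑ) with hh
  have hfm := measurable_indicator_enorm_magLap isOpen_ball hA hu
  have hhm : Measurable h := measurable_ballPotential hfm r
  set M := eLpNorm u 1 (avgMeasure x₀ (2 * r)) with hM
  have hind : ((ball x₀ (2 * r)).indicator fun y => ‖magLap A u y‖ₑ) =
      (ball x₀ (2 * r)).indicator fun y => ‖F y‖ₑ := by
    ext y
    by_cases hy : y ∈ ball x₀ (2 * r)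
    · simp only [indicator_of_mem hy, hF y hy]
    · simp only [indicator_of_notMem hy]
  have hhq : eLpNorm h q (avgMeasure x₀ r) ≤
      Cp * ((2 ^ d) ^ p⁻¹.toReal * eLpNorm F p (avgMeasure x₀ (2 * r))) := by
    rw [← rpow_lintegral_indicator_eq x₀ hr hp0 hpt F, ← hind]
    exact hpot x₀ r hr _ hfm
  have hae : ∀ᵐ x ∂(avgMeasure x₀ r), ‖u x‖ₑ ≤ ‖C₁ * M + κ⁻¹ * ENNReal.ofReal (r ^ 2) * h x‖ₑ := by
    refine Measure.ae_smul_measure ?_ _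
    filter_upwards [ae_restrict_mem measurableSet_ball] with x hx
    have hb := enorm_mul_le hr hx hA hu
    rw [enorm_eq_self]
    calc ‖u x‖ₑ = κ⁻¹ * (‖u x‖ₑ * κ) := by
          rw [mul_comm, mul_assoc, ENNReal.mul_inv_cancel hκ hκ', mul_one]
      _ ≤ _ := mul_le_mul' le_rfl hb
      _ = _ := by rw [hC₁_def]; ring
  have hq0 : q ≠ 0 := (zero_le.trans_lt hpq).ne'
  have hC : ENNReal.ofReal (C₁.toReal + C₂.toReal + 1) = C₁ + C₂ + 1 := by
    rw [ENNReal.ofReal_add (by positivity) zero_le_one, ENNReal.ofReal_add (by positivity)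
      (by positivity), ENNReal.ofReal_toReal hC₁, ENNReal.ofReal_toReal hC₂, ENNReal.ofReal_one]
  calc eLpNorm u q (avgMeasure x₀ r)
      ≤ eLpNorm ((fun _ => C₁ * M) + fun x => κ⁻¹ * ENNReal.ofReal (r ^ 2) * h x) q
          (avgMeasure x₀ r) := eLpNorm_mono_enorm_ae hae
    _ ≤ eLpNorm (fun _ => C₁ * M) q (avgMeasure x₀ r) +
          eLpNorm (fun x => κ⁻¹ * ENNReal.ofReal (r ^ 2) * h x) q (avgMeasure x₀ r) :=
        eLpNorm_add_le aestronglyMeasurable_const (hhm.const_mul _).aestronglyMeasurable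
          (hp1.trans hpq.le)
    _ ≤ C₁ * M + κ⁻¹ * ENNReal.ofReal (r ^ 2) * eLpNorm h q (avgMeasure x₀ r) := by
        gcongr
        · rw [eLpNorm_const _ hq0 (NeZero.ne _)]
          simp
        · exact eLpNorm_le_mul_eLpNorm_of_ae_le_mul'' q hhm.aestronglyMeasurable (by simp)
    _ ≤ C₁ * M + κ⁻¹ * ENNReal.ofReal (r ^ 2) *
          (Cp * ((2 ^ d) ^ p⁻¹.toReal * eLpNorm F p (avgMeasure x₀ (2 * r)))) := by gcongr
    _ = C₁ * M + C₂ * ENNReal.ofReal (r ^ 2) * eLpNorm F p (avgMeasure x₀ (2 * r)) := by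
        rw [hC₂_def]; ring
    _ ≤ _ := by
        rw [ENNReal.ofReal_mul (by positivity), hC]
        gcongr
        · exact le_add_right (le_add_right le_rfl)
        · exact le_add_right (le_add_left le_rfl)
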